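/- The satisfiability problem for CCTL±1 is undecidable: with respect to a natural encoding of CCTL±1 formulas into ℕ, the predicate 'there exist a finite Kripke structure S and a state q of S such that q ⊨_S Φ' is not computable. -/

import Mathlib

open scoped Classical

noncomputable section

/-- A Kripke structure over atomic propositions indexed by `ℕ`. -/
structure Kripke (Q : Type) where
  R : Q → Q → Prop
  total : ∀ q, ∃ q', R q q'
  label : Q → ℕ → Prop

/-- An (infinite) run of a Kripke structure. -/
def Kripke.Run {Q : Type} (S : Kripke Q) (ρ : ℕ → Q) : Prop :=
  ∀ i, S.R (ρ i) (ρ (i + 1))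

/-- The strict prefix `ρ(0) ⋯ ρ(n-1)` of a run (`n` states). -/
def runPrefix {Q : Type} (ρ : ℕ → Q) (n : ℕ) : List Q :=
  (List.range n).map ρ

/-- The number of states of a finite prefix satisfying a predicate. -/
def countSat {Q : Type} (p : Q → Prop) : List Q → ℕ
  | [] => 0
  | s :: t => (if p s then 1 else 0) + countSat p t

/-- Comparison operators `<, ≤, =, ≥, >`. -/
inductive Cmp where
  | lt | le | eq | ge | gt

def Cmp.eval : Cmp → ℤ → ℤ → Prop
  | .lt, a, b => a < b
  | .le, a, b => a ≤ b
  | .eq, a, b => a = b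
  | .ge, a, b => a ≥ b
  | .gt, a, b => a > b

mutual
/-- CCTL±1 formulas: until modalities carry a single atomic constraint
`(Σᵢ αᵢ·#φᵢ) ∼ k` with integer coefficients (well-formed ones have all
coefficients in `{−1,1}`, see `CForm.PM`). -/
inductive CForm : Type where
  | atom : ℕ → CForm
  | and : CForm → CForm → CForm
  | not : CForm → CForm
  | eu : CForm → LinExp → Cmp → ℤ → CForm → CForm
  | au : CForm → LinExp → Cmp → ℤ → CForm → CForm

inductive LinExp : Type where
  | term : ℤ → CForm → LinExp
  | add : LinExp → LinExp → LinExp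
end

mutual
/-- Satisfaction of a CCTL±1 formula at a state. -/
def sat {Q : Type} (S : Kripke Q) : CForm → Q → Prop
  | .atom p, q => S.label q p
  | .and φ ψ, q => sat S φ q ∧ sat S ψ q
  | .not φ, q => ¬ sat S φ q
  | .eu φ e c k ψ, q => ∃ ρ, S.Run ρ ∧ ρ 0 = q ∧
      ∃ i, sat S ψ (ρ i) ∧ c.eval (lval S e (runPrefix ρ i)) k ∧
        ∀ j < i, sat S φ (ρ j)
  | .au φ e c k ψ, q => ∀ ρ, S.Run ρ → ρ 0 = q →
      ∃ i, sat S ψ (ρ i) ∧ c.eval (lval S e (runPrefix ρ i)) k ∧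
        ∀ j < i, sat S φ (ρ j)
termination_by φ _ => sizeOf φ

def lval {Q : Type} (S : Kripke Q) : LinExp → List Q → ℤ
  | .term a φ, σ => a * (countSat (fun s => sat S φ s) σ : ℤ)
  | .add e f, σ => lval S e σ + lval S f σ
termination_by e _ => sizeOf e
end

mutual
/-- All coefficients of the formula belong to `{−1, 1}` (CCTL±1). -/
def CForm.PM : CForm → Prop
  | .atom _ => True
  | .and φ ψ => φ.PM ∧ ψ.PM
  | .not φ => φ.PM
  | .eu φ e _ _ ψ => φ.PM ∧ e.PM ∧ ψ.PM
  | .au φ e _ _ ψ => φ.PM ∧ e.PM ∧ ψ.PM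

def LinExp.PM : LinExp → Prop
  | .term a φ => (a = 1 ∨ a = -1) ∧ φ.PM
  | .add e f => e.PM ∧ f.PM
end

mutual
/-- A natural (Gödel) encoding of formulas as natural numbers. -/
def encForm : CForm → ℕ
  | .atom p => Nat.pair 0 p
  | .and φ ψ => Nat.pair 1 (Nat.pair (encForm φ) (encForm ψ))
  | .not φ => Nat.pair 2 (encForm φ)
  | .eu φ e c k ψ => Nat.pair 3 (Nat.pair (encForm φ) (Nat.pair (encLin e)
      (Nat.pair (match c with | .lt => 0 | .le => 1 | .eq => 2 | .ge => 3 | .gt => 4)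
        (Nat.pair (Encodable.encode k) (encForm ψ)))))
  | .au φ e c k ψ => Nat.pair 4 (Nat.pair (encForm φ) (Nat.pair (encLin e)
      (Nat.pair (match c with | .lt => 0 | .le => 1 | .eq => 2 | .ge => 3 | .gt => 4)
        (Nat.pair (Encodable.encode k) (encForm ψ)))))

def encLin : LinExp → ℕ
  | .term a φ => Nat.pair 0 (Nat.pair (Encodable.encode a) (encForm φ))
  | .add e f => Nat.pair 1 (Nat.pair (encLin e) (encLin f))
end

/-- A finite presentation of a Kripke structure. -/
structure FinKS where
  n : ℕ
  edges : List (ℕ × ℕ)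
  labels : List (ℕ × ℕ)

/-- Totality of the presented transition relation. -/
def FinKS.Total (M : FinKS) : Prop :=
  ∀ q : Fin M.n, ∃ q' : Fin M.n, ((q : ℕ), (q' : ℕ)) ∈ M.edges

/-- The Kripke structure presented by `M`. -/
def FinKS.toKripke (M : FinKS) (h : M.Total) : Kripke (Fin M.n) where
  R a b := ((a : ℕ), (b : ℕ)) ∈ M.edges
  total := h
  label a p := ((a : ℕ), p) ∈ M.labels

/-! ### Register programs -/

open Relation Function

/-- Atomic instructions acting on a bank of registers. -/
inductive Act where
  | inc : ℕ → Act
  | dec : ℕ → Act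
  | eq : ℕ → ℕ → Act

/-- The effect of an instruction; `dec` blocks on zero and `eq` is a blocking test. -/
def Act.Step : Act → (ℕ → ℕ) → (ℕ → ℕ) → Prop
  | .inc i, s, t => t = update s i (s i + 1)
  | .dec i, s, t => s i ≠ 0 ∧ t = update s i (s i - 1)
  | .eq i j, s, t => s i = s j ∧ t = s

/-- Nondeterministic register programs. -/
inductive Prog where
  | act : Act → Prog
  | seq : Prog → Prog → Prog
  | star : Prog → Prog

/-- The input-output relation of a program. -/
def Prog.Rel : Prog → (ℕ → ℕ) → (ℕ → ℕ) → Prop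
  | .act a => a.Step
  | .seq p q => Comp p.Rel q.Rel
  | .star p => ReflTransGen p.Rel

/-- All registers from `N` on hold zero. -/
def Clean (N : ℕ) (s : ℕ → ℕ) : Prop := ∀ r, N ≤ r → s r = 0

/-- Some program has the input-output relation `T` on states that are clean from `N` on,
and `T` keeps states clean. -/
def Realizable (N : ℕ) (T : (ℕ → ℕ) → (ℕ → ℕ) → Prop) : Prop :=
  ∃ p : Prog, ∀ s, Clean N s → ∀ t, (p.Rel s t ↔ T s t) ∧ (T s t → Clean N t)

/-- Some program tests the property `K` of states that are clean from `N` on. -/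
def Testable (N : ℕ) (K : (ℕ → ℕ) → Prop) : Prop :=
  Realizable N fun s s' => s' = s ∧ K s

theorem Clean.mono {N M : ℕ} {s : ℕ → ℕ} (h : Clean N s) (hNM : N ≤ M) : Clean M s :=
  fun r hr => h r (hNM.trans hr)

theorem Clean.update {N i x : ℕ} {s : ℕ → ℕ} (h : Clean N s) (hi : i < N) :
    Clean N (update s i x) := fun r hr => by
  rw [update_of_ne (by omega)]
  exact h r hr

theorem Realizable.congr {N : ℕ} {T T' : (ℕ → ℕ) → (ℕ → ℕ) → Prop} (h : Realizable N T)
    (hT : ∀ s s', Clean N s → (T s s' ↔ T' s s')) : Realizable N T' := by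
  obtain ⟨p, hp⟩ := h
  refine ⟨p, fun s hs s' => ?_⟩
  rw [← hT s s' hs]
  exact hp s hs s'

theorem Realizable.comp {N : ℕ} {T T' : (ℕ → ℕ) → (ℕ → ℕ) → Prop} (h : Realizable N T)
    (h' : Realizable N T') : Realizable N (Comp T T') := by
  obtain ⟨p, hp⟩ := h
  obtain ⟨q, hq⟩ := h'
  refine ⟨.seq p q, fun s hs s' => ⟨⟨?_, ?_⟩, ?_⟩⟩
  · rintro ⟨u, hu, hu'⟩
    have hT := (hp s hs u).1.1 hu
    exact ⟨u, hT, (hq u ((hp s hs u).2 hT) s').1.1 hu'⟩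
  · rintro ⟨u, hu, hu'⟩
    exact ⟨u, (hp s hs u).1.2 hu, (hq u ((hp s hs u).2 hu) s').1.2 hu'⟩
  · rintro ⟨u, hu, hu'⟩
    exact (hq u ((hp s hs u).2 hu) s').2 hu'

theorem Realizable.star {N : ℕ} {T : (ℕ → ℕ) → (ℕ → ℕ) → Prop} (h : Realizable N T) :
    Realizable N (ReflTransGen T) := by
  obtain ⟨p, hp⟩ := h
  have clean : ∀ s s', Clean N s → ReflTransGen T s s' → Clean N s' := by
    intro s s' hs h
    induction h with
    | refl => exact hs
    | tail _ h ih => exact (hp _ ih _).2 h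
  refine ⟨.star p, fun s hs s' => ⟨⟨fun h => ?_, fun h => ?_⟩, clean s s' hs⟩⟩
  · replace h : ReflTransGen p.Rel s s' := h
    induction h with
    | refl => exact .refl
    | tail _ h ih => exact ReflTransGen.tail ih ((hp _ (clean _ _ hs ih) _).1.1 h)
  · change ReflTransGen p.Rel s s'
    induction h with
    | refl => exact .refl
    | tail h' h ih => exact ih.tail ((hp _ (clean _ _ hs h') _).1.2 h)

theorem Realizable.inc {N i : ℕ} (hi : i < N) :
    Realizable N fun s s' => s' = update s i (s i + 1) :=
  ⟨.act (.inc i), fun _ hs _ => ⟨Iff.rfl, by rintro rfl; exact hs.update hi⟩⟩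

theorem Realizable.dec {N i : ℕ} (hi : i < N) :
    Realizable N fun s s' => s i ≠ 0 ∧ s' = update s i (s i - 1) :=
  ⟨.act (.dec i), fun _ hs _ => ⟨Iff.rfl, by rintro ⟨-, rfl⟩; exact hs.update hi⟩⟩

theorem Testable.eq (N i j : ℕ) : Testable N fun s => s i = s j :=
  ⟨.act (.eq i j), fun _ hs _ => ⟨and_comm, by rintro ⟨rfl, -⟩; exact hs⟩⟩

theorem Testable.congr {N : ℕ} {K K' : (ℕ → ℕ) → Prop} (h : Testable N K)
    (hK : ∀ s, Clean N s → (K s ↔ K' s)) : Testable N K' :=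
  Realizable.congr h fun s s' hs => by rw [hK s hs]

theorem Testable.eq_zero (N i : ℕ) : Testable N fun s => s i = 0 :=
  (Testable.eq N i N).congr fun s hs => by rw [hs N le_rfl]

theorem Testable.true (N : ℕ) : Testable N fun _ => True :=
  (Testable.eq N 0 0).congr fun _ _ => by simp

theorem Testable.and {N : ℕ} {K K' : (ℕ → ℕ) → Prop} (h : Testable N K) (h' : Testable N K') :
    Testable N fun s => K s ∧ K' s :=
  (Realizable.comp h h').congr fun s s' _ => by
    constructor
    · rintro ⟨u, ⟨rfl, hK⟩, rfl, hK'⟩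
      exact ⟨rfl, hK, hK'⟩
    · rintro ⟨rfl, hK, hK'⟩
      exact ⟨_, ⟨rfl, hK⟩, rfl, hK'⟩

theorem reflTransGen_inc_iff {i : ℕ} {s s' : ℕ → ℕ} :
    ReflTransGen (fun s s' : ℕ → ℕ => s' = update s i (s i + 1)) s s' ↔
      ∃ x, s i ≤ x ∧ s' = update s i x := by
  constructor
  · intro h
    induction h with
    | refl => exact ⟨s i, le_rfl, by simp⟩
    | tail _ h ih =>
      obtain ⟨x, hx, rfl⟩ := ih
      exact ⟨x + 1, by omega, by simpa using h⟩
  · rintro ⟨x, hx, rfl⟩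
    induction x, hx using Nat.le_induction with
    | base => simpa using ReflTransGen.refl
    | succ x _ ih => exact ih.tail (by simp)

theorem reflTransGen_dec_iff {i : ℕ} {s s' : ℕ → ℕ} :
    ReflTransGen (fun s s' : ℕ → ℕ => s i ≠ 0 ∧ s' = update s i (s i - 1)) s s' ↔
      ∃ x, x ≤ s i ∧ s' = update s i x := by
  constructor
  · intro h
    induction h with
    | refl => exact ⟨s i, le_rfl, by simp⟩
    | tail _ h ih =>
      obtain ⟨x, hx, rfl⟩ := ih
      exact ⟨x - 1, by omega, by simpa using h.2⟩
  · rintro ⟨x, hx, rfl⟩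
    induction hx using Nat.decreasingInduction with
    | self => simpa using ReflTransGen.refl
    | of_succ x _ ih => exact ih.tail (by simp)

/-- Registers can be overwritten by arbitrary values. -/
theorem Realizable.havoc {N i : ℕ} (hi : i < N) :
    Realizable N fun s s' => ∃ x, s' = update s i x :=
  ((Realizable.inc hi).star.comp (Realizable.dec hi).star).congr fun s s' _ => by
    constructor
    · rintro ⟨u, hu, hu'⟩
      obtain ⟨x, -, rfl⟩ := reflTransGen_inc_iff.1 hu
      obtain ⟨y, -, rfl⟩ := reflTransGen_dec_iff.1 hu'
      exact ⟨y, by simp⟩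
    · rintro ⟨x, rfl⟩
      exact ⟨update s i (s i + x), reflTransGen_inc_iff.2 ⟨_, by omega, rfl⟩,
        reflTransGen_dec_iff.2 ⟨x, by simp, by simp⟩⟩

theorem Realizable.assign {N i j : ℕ} (hi : i < N) (hij : j ≠ i) :
    Realizable N fun s s' => s' = update s i (s j) :=
  ((Realizable.havoc hi).comp (Testable.eq N i j)).congr fun s s' _ => by
    constructor
    · rintro ⟨u, ⟨x, rfl⟩, rfl, h⟩
      rw [update_self, update_of_ne hij] at h
      rw [h]
    · rintro rfl
      exact ⟨_, ⟨_, rfl⟩, rfl, by simp [hij]⟩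

/-- Introduction of a local register `N`. -/
theorem Realizable.withLocal {N : ℕ} {T : (ℕ → ℕ) → (ℕ → ℕ) → Prop} (h : Realizable (N + 1) T) :
    Realizable N fun s s' => s' N = 0 ∧ ∃ x x', T (update s N x) (update s' N x') := by
  obtain ⟨p, hp⟩ := ((Realizable.havoc N.lt_succ_self).comp (h.comp
    ((Realizable.havoc N.lt_succ_self).comp (Testable.eq_zero (N + 1) N))))
  refine ⟨p, fun s hs s' => ?_⟩
  have hp := hp s (hs.mono N.le_succ) s'
  suffices key : _ ↔ s' N = 0 ∧ ∃ x x', T (update s N x) (update s' N x') by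
    refine ⟨hp.1.trans key, fun h r hr => ?_⟩
    rcases hr.eq_or_lt with rfl | hr
    · exact h.1
    · exact hp.2 (key.2 h) r hr
  constructor
  · rintro ⟨_, ⟨x, rfl⟩, u, hT, _, ⟨y, rfl⟩, rfl, h0⟩
    exact ⟨h0, x, u N, by simpa using hT⟩
  · rintro ⟨h0, x, x', hT⟩
    exact ⟨_, ⟨x, rfl⟩, _, hT, s', ⟨0, by simp [← h0]⟩, rfl, h0⟩

theorem Testable.exists {N : ℕ} {K : (ℕ → ℕ) → Prop} (h : Testable (N + 1) K) :
    Testable N fun s => ∃ x, K (update s N x) :=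
  (Realizable.withLocal h).congr fun s s' hs => by
    constructor
    · rintro ⟨h0, x, x', h, hK⟩
      refine ⟨?_, x, hK⟩
      funext r
      have := congrFun h r
      by_cases hr : r = N
      · rw [hr, h0, hs N le_rfl]
      · simpa [hr] using this
    · rintro ⟨rfl, x, hK⟩
      exact ⟨hs N le_rfl, x, x, rfl, hK⟩

/-- Simultaneous introduction of `m` existentially quantified registers. -/
theorem Testable.exists_extension {N : ℕ} {K : (ℕ → ℕ) → Prop} (m : ℕ)
    (h : Testable (N + m) K) :
    Testable N fun s => ∃ s', (∀ r < N, s' r = s r) ∧ Clean (N + m) s' ∧ K s' := by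
  induction m generalizing N with
  | zero =>
    refine h.congr fun s hs => ⟨fun hK => ⟨s, fun _ _ => rfl, hs, hK⟩, ?_⟩
    rintro ⟨s', h, hs', hK⟩
    have : s' = s := funext fun r => by
      by_cases hr : r < N
      · exact h r hr
      · rw [hs r (by omega), hs' r (by omega)]
    rwa [← this]
  | succ m ih =>
    refine (ih (N := N + 1) (by rwa [show N + 1 + m = N + (m + 1) by omega])).exists.congr
      fun s hs => ⟨?_, ?_⟩
    · rintro ⟨x, s', h, hs', hK⟩
      refine ⟨s', fun r hr => ?_, hs'.mono (by omega), hK⟩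
      rw [h r (by omega), update_of_ne (by omega)]
    · rintro ⟨s', h, hs', hK⟩
      refine ⟨s' N, s', fun r hr => ?_, hs'.mono (by omega), hK⟩
      by_cases hr' : r = N
      · simp [hr']
      · rw [update_of_ne hr', h r (by omega)]

theorem Testable.forall_fin {N n : ℕ} {K : Fin n → (ℕ → ℕ) → Prop} (h : ∀ i, Testable N (K i)) :
    Testable N fun s => ∀ i, K i s := by
  induction n with
  | zero => exact (Testable.true N).congr fun s _ => by simp
  | succ n ih =>
    exact ((h 0).and (ih fun i => h i.succ)).congr fun s _ =>
      (Fin.forall_fin_succ (P := fun i => K i s)).symm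

theorem Testable.eq_succ {N i j : ℕ} (hi : i < N) (hj : j < N) :
    Testable N fun s => s i + 1 = s j := by
  refine (Realizable.withLocal (((Realizable.assign N.lt_succ_self (show i ≠ N by omega)).comp
    (Realizable.inc N.lt_succ_self)).comp (Testable.eq (N + 1) N j))).congr fun s s' hs => ?_
  constructor
  · rintro ⟨h0, x, x', _, ⟨_, rfl, rfl⟩, h, h'⟩
    simp only [update_self, update_idem, update_of_ne (show i ≠ N by omega),
      update_of_ne (show j ≠ N by omega)] at h h'
    refine ⟨funext fun r => ?_, h'⟩
    by_cases hr : r = N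
    · rw [hr, h0, hs N le_rfl]
    · simpa [hr] using congrFun h r
  · rintro ⟨rfl, h⟩
    refine ⟨hs N le_rfl, 0, s' j, _, ⟨_, rfl, rfl⟩, ?_, ?_⟩ <;>
    simp [update_of_ne (show i ≠ N by omega), update_of_ne (show j ≠ N by omega), h]

/-! ### Primitive recursive functions are testable -/

theorem List.Vector.map_congr_of_mem {α β : Type*} {n : ℕ} {xs : List.Vector α n} {s t : α → β}
    (h : ∀ i, s (xs.get i) = t (xs.get i)) : xs.map s = xs.map t := by
  ext i
  simp [h]

theorem iterate_loop {i a : ℕ} {f : ℕ} {g : ℕ → ℕ → ℕ}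
    {F : (ℕ → ℕ) → ℕ → ℕ} {s : ℕ → ℕ} (hi : s i = 0) (ha : s a = f)
    (hF : ∀ k v, F (update (update s a v) i k) = update (update s a (g k v)) i (k + 1)) (k : ℕ) :
    F^[k] s = update (update s a (Nat.rec f g k)) i k := by
  induction k with
  | zero =>
    change s = update (update s a f) i 0
    rw [← ha, update_eq_self, ← hi, update_eq_self]
  | succ k ih => rw [iterate_succ_apply', ih, hF]

theorem reflTransGen_functional_iff {α : Type*} {F : α → α} {a b : α} :
    ReflTransGen (fun a b => b = F a) a b ↔ ∃ k, b = F^[k] a := by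
  constructor
  · intro h
    induction h with
    | refl => exact ⟨0, rfl⟩
    | tail _ h ih =>
      obtain ⟨k, rfl⟩ := ih
      exact ⟨k + 1, by rw [h, iterate_succ_apply']⟩
  · rintro ⟨k, rfl⟩
    induction k with
    | zero => exact .refl
    | succ k ih => exact ih.tail (iterate_succ_apply' _ _ _)

/-- One round of primitive recursion: `a := g (i, a, xs)` followed by `i := i + 1`. -/
theorem Realizable.loop_body {N n : ℕ} {g : List.Vector ℕ (n + 2) → ℕ} {i a : ℕ}
    {xs : List.Vector ℕ n} (hi : i < N) (ha : a < N) (hia : i ≠ a) (hxs : ∀ j, xs.get j < N)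
    (hg : Testable (N + 1) fun s => g ((i ::ᵥ a ::ᵥ xs).map s) = s N) :
    Realizable N fun s s' =>
      s' = update (update s a (g (s i ::ᵥ s a ::ᵥ xs.map s))) i (s i + 1) := by
  have hiN : i ≠ N := by omega
  have haN : a ≠ N := by omega
  have hxs' (s : ℕ → ℕ) (x : ℕ) : xs.map (update s N x) = xs.map s :=
    List.Vector.map_congr_of_mem fun j => update_of_ne (hxs j).ne _ _
  refine (Realizable.withLocal (hg.comp ((Realizable.assign (i := a) (j := N) (by omega)
    haN.symm).comp (Realizable.inc (i := i) (by omega))))).congr fun s s' hs => ?_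
  simp only [List.Vector.map_cons]
  constructor
  · rintro ⟨h0, x, x', _, ⟨rfl, h⟩, _, rfl, h'⟩
    simp only [update_self, update_of_ne hiN, update_of_ne haN, hxs', update_of_ne hia] at h h'
    rw [h]
    funext r
    by_cases hr : r = N
    · simp [hr, h0, hiN.symm, haN.symm, hs N le_rfl]
    · have := congrFun h' r
      simp only [update_of_ne hr] at this
      rw [this]
      simp [update_apply, hr]
  · rintro rfl
    refine ⟨by simp [hiN.symm, haN.symm, hs N le_rfl], g (s i ::ᵥ s a ::ᵥ xs.map s),
      g (s i ::ᵥ s a ::ᵥ xs.map s), _, ⟨rfl, ?_⟩, _, rfl, ?_⟩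
    · simp only [update_self, update_of_ne hiN, update_of_ne haN, hxs']
    · simp only [update_self, update_of_ne hiN, update_of_ne hia]
      rw [update_comm haN.symm, update_comm hiN.symm]

theorem Testable.prec {N n : ℕ} {f : List.Vector ℕ n → ℕ} {g : List.Vector ℕ (n + 2) → ℕ}
    {xs : List.Vector ℕ (n + 1)} {y : ℕ} (hxs : ∀ j, xs.get j < N) (hy : y < N)
    (hf : Testable (N + 1 + 1) fun s => f (xs.tail.map s) = s (N + 1))
    (hg : Testable (N + 1 + 1 + 1)
      fun s => g ((N ::ᵥ (N + 1) ::ᵥ xs.tail).map s) = s (N + 1 + 1)) :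
    Testable N fun s => Nat.rec (f (xs.map s).tail) (fun k v => g (k ::ᵥ v ::ᵥ (xs.map s).tail))
      (xs.map s).head = s y := by
  have hts (j) : xs.tail.get j < N := by rw [List.Vector.get_tail_succ]; exact hxs _
  have hh : xs.head < N := by rw [← List.Vector.get_zero]; exact hxs 0
  have hxs' (s : ℕ → ℕ) (x z : ℕ) :
      xs.tail.map (update (update s (N + 1) x) N z) = xs.tail.map s :=
    List.Vector.map_congr_of_mem fun j => by
      have := hts j
      rw [update_of_ne (by omega), update_of_ne (by omega)]
  have hbody := Realizable.loop_body (N := N + 1 + 1) (i := N) (a := N + 1) (by omega) (by omega)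
    (by omega) (fun j => (hts j).trans (by omega)) hg
  refine (Realizable.withLocal (Realizable.withLocal ((hf.and (Testable.eq_zero _ N)).comp
    (hbody.star.comp ((Testable.eq _ N xs.head).and (Testable.eq _ (N + 1) y)))))).congr
    fun s s' hs => ?_
  simp only [List.Vector.tail_map, List.Vector.head_map]
  have hN : N ≠ N + 1 := by omega
  have iter (s : ℕ → ℕ) (k : ℕ) :
      (fun s => update (update s (N + 1) (g (s N ::ᵥ s (N + 1) ::ᵥ xs.tail.map s))) N (s N + 1))^[k]
        (update (update s N 0) (N + 1) (f (xs.tail.map s))) =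
      update (update s N k) (N + 1)
        (Nat.rec (f (xs.tail.map s)) (fun k v => g (k ::ᵥ v ::ᵥ xs.tail.map s)) k) := by
    rw [iterate_loop (i := N) (a := N + 1) (f := f (xs.tail.map s))
       (g := fun k v => g (k ::ᵥ v ::ᵥ xs.tail.map s))
      (by simp) (by simp)]
    · simp only [update_comm hN, update_idem]
    · intro k v
      simp only [update_self, update_of_ne hN.symm, update_comm hN, update_idem, hxs']
  have hhN : xs.head ≠ N ∧ xs.head ≠ N + 1 := by omega
  have hyN : y ≠ N ∧ y ≠ N + 1 := by omega
  constructor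
  · rintro ⟨h0, x, x', h0', z, z', _, ⟨rfl, hz, hx⟩, _, hloop, h, hk, hv⟩
    rw [update_of_ne hN, update_self] at hx
    subst hx
    rw [update_self, update_comm hN, hxs'] at hz
    subst hz
    obtain ⟨k, rfl⟩ := reflTransGen_functional_iff.1 hloop
    rw [iter] at h hk hv
    simp only [update_self, update_of_ne hhN.1, update_of_ne hhN.2, update_of_ne hyN.1,
      update_of_ne hyN.2, update_of_ne hN, update_of_ne hN.symm] at hk hv h0'
    subst hk
    refine ⟨funext fun r => ?_, hv⟩
    have := congrFun h r
    by_cases h1 : r = N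
    · rw [h1, h0, hs N le_rfl]
    by_cases h2 : r = N + 1
    · rw [h2, h0', hs _ N.le_succ]
    simpa [h1, h2] using this
  · rintro ⟨rfl, h⟩
    refine ⟨hs N le_rfl, 0, s' xs.head, ?_, f (xs.tail.map s'), s' y, _, ⟨rfl, ?_, ?_⟩, _,
      reflTransGen_functional_iff.2 ⟨s' xs.head, rfl⟩, ?_, ?_, ?_⟩
    · rw [update_of_ne hN.symm, hs _ N.le_succ]
    · rw [update_self, update_comm hN, hxs']
    · rw [update_of_ne hN, update_self]
    · rw [iter, h]
    · rw [iter, update_of_ne hN, update_self, update_of_ne hhN.2, update_of_ne hhN.1]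
    · rw [iter, update_self, update_of_ne hyN.2, update_of_ne hyN.1, h]

theorem Nat.Primrec'.testable {n : ℕ} {f : List.Vector ℕ n → ℕ} (hf : Nat.Primrec' f) :
    ∀ (N : ℕ) (xs : List.Vector ℕ n) (y : ℕ), (∀ j, xs.get j < N) → y < N →
      Testable N fun s => f (xs.map s) = s y := by
  induction hf with
  | zero =>
    intro N xs y _ _
    exact (Testable.eq_zero N y).congr fun s _ => eq_comm
  | succ =>
    intro N xs y hxs hy
    refine (Testable.eq_succ (i := xs.head) ?_ hy).congr fun s _ => ?_
    · rw [← List.Vector.get_zero]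
      exact hxs 0
    · simp only [List.Vector.head_map, Nat.succ_eq_add_one]
  | get i =>
    intro N xs y _ _
    exact (Testable.eq N (xs.get i) y).congr fun s _ => by
      simp only [List.Vector.get_map]
  | @comp m n f g _ _ ihf ihg =>
    intro N xs y hxs hy
    refine (Testable.exists_extension n ((Testable.forall_fin fun i : Fin n =>
      ihg i (N + n) xs (N + i) (fun j => (hxs j).trans_le (by omega)) (by omega)).and
      (ihf (N + n) (List.Vector.ofFn fun i => N + i) y (by simp) (by omega)))).congr fun s hs => ?_
    have ofFn_map (s : ℕ → ℕ) : (List.Vector.ofFn fun i : Fin n => N + (i : ℕ)).map s =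
        List.Vector.ofFn fun i : Fin n => s (N + i) := by
      ext i
      simp
    simp only [ofFn_map]
    constructor
    · rintro ⟨s', h, -, hg, hf⟩
      have hmap : xs.map s' = xs.map s := List.Vector.map_congr_of_mem fun j => h _ (hxs j)
      simp only [hmap] at hg
      rw [← h y hy, ← hf]
      simp only [hg]
    · intro hf
      let s' : ℕ → ℕ := fun r => if r < N then s r else
        if hr : r - N < n then g ⟨r - N, hr⟩ (xs.map s) else 0
      have h : ∀ r < N, s' r = s r := fun r hr => if_pos hr
      have hs' (i : Fin n) : s' (N + i) = g i (xs.map s) := by simp [s']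
      refine ⟨s', h, fun r hr => ?_, fun i => ?_, ?_⟩
      · simp [s', show ¬ r < N by omega, show ¬ r - N < n by omega]
      · rw [hs', List.Vector.map_congr_of_mem fun j => h _ (hxs j)]
      · simp only [hs', h y hy, hf]
  | @prec n f g _ _ ihf ihg =>
    intro N xs y hxs hy
    have hts (j) : xs.tail.get j < N := by rw [List.Vector.get_tail_succ]; exact hxs _
    refine Testable.prec hxs hy (ihf _ _ _ (fun j => (hts j).trans (by omega)) (by omega))
      (ihg _ _ _ (fun j => ?_) (by omega))
    refine Fin.cases ?_ (fun j => Fin.cases ?_ (fun j => ?_) j) j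
    · rw [List.Vector.get_cons_zero]
      omega
    · rw [List.Vector.get_cons_succ, List.Vector.get_cons_zero]
      omega
    · rw [List.Vector.get_cons_succ, List.Vector.get_cons_succ]
      exact (hts j).trans (by omega)

/-- There is a register program whose set of possible final values of register `0`, starting from
the all-zero state, is not computable. -/
theorem exists_prog_not_computable : ∃ p : Prog,
    ¬ ComputablePred fun n : ℕ => ∃ s, p.Rel 0 s ∧ s 0 = n := by
  let f : List.Vector ℕ 2 → ℕ := fun v =>
    cond (Nat.Partrec.Code.evaln v.head (Denumerable.ofNat Nat.Partrec.Code v.tail.head) 0).isSome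
      0 1
  have hf : Primrec f :=
    Primrec.cond (Primrec.option_isSome.comp (Nat.Partrec.Code.primrec_evaln.comp
      ((Primrec.vector_head.pair ((Primrec.ofNat _).comp
        (Primrec.vector_head.comp Primrec.vector_tail))).pair (Primrec.const 0))))
      (.const 0) (.const 1)
  have hdom (n : ℕ) : (Nat.Partrec.Code.eval (Denumerable.ofNat Nat.Partrec.Code n) 0).Dom ↔
      ∃ k, f (k ::ᵥ n ::ᵥ .nil) = 0 := by
    simp only [f, Part.dom_iff_mem, Nat.Partrec.Code.evaln_complete]
    rw [exists_comm]
    refine exists_congr fun k => ?_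
    rw [List.Vector.head_cons, List.Vector.tail_cons, List.Vector.head_cons]
    refine Option.isSome_iff_exists.symm.trans ?_
    cases (Nat.Partrec.Code.evaln k (Denumerable.ofNat Nat.Partrec.Code n) 0).isSome <;> simp
  obtain ⟨p, hp⟩ := (Realizable.havoc (N := 3) (i := 0) (by omega)).comp
    ((Realizable.havoc (N := 3) (i := 1) (by omega)).comp
      (((Nat.Primrec'.of_prim hf).testable 3 (1 ::ᵥ 0 ::ᵥ .nil) 2 (by decide) (by omega)).and
        (Testable.eq_zero 3 2)))
  have hrel (n : ℕ) : (∃ s, p.Rel 0 s ∧ s 0 = n) ↔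
      (Nat.Partrec.Code.eval (Denumerable.ofNat Nat.Partrec.Code n) 0).Dom := by
    rw [hdom]
    constructor
    · rintro ⟨s, hs, rfl⟩
      obtain ⟨_, ⟨x, rfl⟩, _, ⟨y, rfl⟩, rfl, h, h2⟩ := (hp 0 (fun _ _ => rfl) s).1.1 hs
      exact ⟨y, by simpa using h⟩
    · rintro ⟨k, hk⟩
      exact ⟨update (update 0 0 n) 1 k, (hp 0 (fun _ _ => rfl) _).1.2
        ⟨_, ⟨n, rfl⟩, _, ⟨k, rfl⟩, rfl, by simpa using hk, by simp⟩, by simp⟩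
  refine ⟨p, fun hc => ComputablePred.halting_problem 0 ?_⟩
  refine ComputablePred.computable_of_manyOneReducible ?_ hc
  refine ⟨Encodable.encode, Computable.encode, fun c => ?_⟩
  exact ((hrel _).trans (by rw [Denumerable.ofNat_encode])).symm

/-! ### Flow graphs -/

/-- A finite control flow graph: every node carries an instruction that is executed when the
node is left; `none` is the exit. -/
structure FlowGraph where
  V : Type
  [fintype : Fintype V]
  act : V → Act
  E : V → Option V → Prop
  init : V

attribute [instance] FlowGraph.fintype

/-- One step of a flow graph. -/
def FlowGraph.Step (G : FlowGraph) : Option G.V × (ℕ → ℕ) → Option G.V × (ℕ → ℕ) → Prop :=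
  fun c d => ∃ v, c.1 = some v ∧ G.E v d.1 ∧ (G.act v).Step c.2 d.2

/-- Reachability of configurations of a flow graph. -/
abbrev FlowGraph.Reach (G : FlowGraph) :=
  ReflTransGen G.Step

/-- Sequential composition of flow graphs. -/
def FlowGraph.seq (G H : FlowGraph) : FlowGraph where
  V := G.V ⊕ H.V
  act := Sum.elim G.act H.act
  E := Sum.elim (fun v o => ∃ o', G.E v o' ∧ o = some (o'.elim (.inr H.init) .inl))
    (fun v o => ∃ o', H.E v o' ∧ o = o'.map .inr)
  init := .inl G.init

/-- Iteration of a flow graph; the new node `none` is the head of the loop. -/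
def FlowGraph.star (G : FlowGraph) : FlowGraph where
  V := Option G.V
  act v := v.elim (.eq 0 0) G.act
  E v o := v.elim (o = none ∨ o = some (some G.init)) fun v => ∃ o', G.E v o' ∧ o = some o'
  init := none

theorem FlowGraph.reach_seq_iff (G H : FlowGraph) (s s' : ℕ → ℕ) :
    (G.seq H).Reach (some (G.seq H).init, s) (none, s') ↔
      ∃ u, G.Reach (some G.init, s) (none, u) ∧ H.Reach (some H.init, u) (none, s') := by
  constructor
  · have key : ∀ c, (G.seq H).Reach (some (G.seq H).init, s) c →
        (∃ v, c.1 = some (.inl v) ∧ G.Reach (some G.init, s) (some v, c.2)) ∨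
        ∃ o u, c.1 = o.map .inr ∧ G.Reach (some G.init, s) (none, u) ∧
          H.Reach (some H.init, u) (o, c.2) := by
      intro c hc
      induction hc with
      | refl => exact .inl ⟨G.init, rfl, .refl⟩
      | @tail c d _ h ih =>
        obtain ⟨w, hw, hE, hs⟩ := h
        rcases ih with ⟨v, hv, hr⟩ | ⟨o, u, ho, hr, hr'⟩
        · obtain rfl : .inl v = w := Option.some_injective _ (hv.symm.trans hw)
          obtain ⟨o', hE, ho'⟩ := hE
          have hr := hr.tail (c := (o', d.2)) ⟨v, rfl, hE, hs⟩
          cases o' with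
          | none => exact .inr ⟨some H.init, d.2, ho', hr, .refl⟩
          | some v' => exact .inl ⟨v', ho', hr⟩
        · obtain ⟨v, rfl, rfl⟩ := Option.map_eq_some_iff.1 (ho.symm.trans hw)
          obtain ⟨o', hE, ho'⟩ := hE
          exact .inr ⟨o', u, ho', hr, hr'.tail ⟨v, rfl, hE, hs⟩⟩
    intro h
    obtain ⟨v, hv, -⟩ | ⟨o, u, ho, hr, hr'⟩ := key _ h
    · cases hv
    · obtain rfl : o = none := Option.map_eq_none_iff.1 ho.symm
      exact ⟨u, hr, hr'⟩
  · rintro ⟨u, hG, hH⟩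
    have h1 := ReflTransGen.lift (p := (G.seq H).Step)
      (fun c : Option G.V × (ℕ → ℕ) => (some (c.1.elim (.inr H.init) .inl), c.2))
      (fun c d => ?_) _ _ hG
    · have h2 := ReflTransGen.lift (p := (G.seq H).Step)
        (fun c : Option H.V × (ℕ → ℕ) => (c.1.map .inr, c.2)) (fun c d => ?_) _ _ hH
      · exact h1.trans h2
      · rintro ⟨v, hv, hE, hs⟩
        exact ⟨.inr v, by simp only [hv]; rfl, ⟨d.1, hE, rfl⟩, hs⟩
    · rintro ⟨v, hv, hE, hs⟩
      exact ⟨.inl v, by simp only [hv]; rfl, ⟨d.1, hE, rfl⟩, hs⟩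

theorem FlowGraph.reach_star_iff (G : FlowGraph) (s s' : ℕ → ℕ) :
    G.star.Reach (some G.star.init, s) (none, s') ↔
      ReflTransGen (fun s s' => G.Reach (some G.init, s) (none, s')) s s' := by
  constructor
  · have key : ∀ c, G.star.Reach (some G.star.init, s) c →
        (∃ v u, c.1 = some (some v) ∧ G.Reach (some G.init, u) (some v, c.2) ∧
          ReflTransGen (fun s s' => G.Reach (some G.init, s) (none, s')) s u) ∨
        ((c.1 = none ∨ c.1 = some none) ∧
          ReflTransGen (fun s s' => G.Reach (some G.init, s) (none, s')) s c.2) := by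
      intro c hc
      induction hc with
      | refl => exact .inr ⟨.inr rfl, .refl⟩
      | @tail c d _ h ih =>
        obtain ⟨w, hw, hE, hs⟩ := h
        rcases ih with ⟨v, u, hv, hr, hu⟩ | ⟨hc, hr⟩
        · obtain rfl : some v = w := Option.some_injective _ (hv.symm.trans hw)
          obtain ⟨o', hE, ho'⟩ := hE
          have hr := hr.tail (c := (o', d.2)) ⟨v, rfl, hE, hs⟩
          cases o' with
          | none => exact .inr ⟨.inr ho', hu.tail hr⟩
          | some v' => exact .inl ⟨v', u, ho', hr, hu⟩
        · obtain rfl : none = w := by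
            rcases hc with hc | hc <;> rw [hc] at hw <;> cases hw
            rfl
          have hdc : d.2 = c.2 := hs.2
          rcases hE with hE | hE
          · exact .inr ⟨.inl hE, hdc ▸ hr⟩
          · exact .inl ⟨G.init, c.2, hE, hdc ▸ .refl, hr⟩
    intro h
    obtain ⟨v, u, hv, -⟩ | ⟨-, h⟩ := key _ h
    · cases hv
    · exact h
  · intro h
    have loop : G.star.Reach (some none, s) (some none, s') := by
      induction h with
      | refl => exact .refl
      | @tail u u' _ h ih =>
        have enter : G.star.Step (some none, u) (some (some G.init), u) :=
          ⟨none, rfl, .inr rfl, rfl, rfl⟩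
        refine (ih.tail enter).trans ?_
        refine ReflTransGen.lift (p := G.star.Step)
          (fun c : Option G.V × (ℕ → ℕ) => (some c.1, c.2))
          (fun c d => ?_) _ _ h
        rintro ⟨v, hv, hE, hs⟩
        exact ⟨some v, by simp [hv], ⟨d.1, hE, rfl⟩, hs⟩
    exact loop.tail ⟨none, rfl, .inl rfl, rfl, rfl⟩

theorem Prog.exists_flowGraph (p : Prog) : ∃ G : FlowGraph, ∀ s s',
    G.Reach (some G.init, s) (none, s') ↔ p.Rel s s' := by
  induction p with
  | act a =>
    refine ⟨⟨Unit, fun _ => a, fun _ o => o = none, ()⟩, fun s s' => ⟨fun h => ?_, fun h => ?_⟩⟩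
    · obtain h | ⟨c, ⟨v, -, hc, hs⟩, h⟩ := h.cases_head
      · cases h
      · obtain h | ⟨d, ⟨w, hw, -⟩, -⟩ := h.cases_head
        · subst h
          exact hs
        · rw [hc] at hw
          cases hw
    · exact .single ⟨(), rfl, rfl, h⟩
  | seq p q ihp ihq =>
    obtain ⟨G, hG⟩ := ihp
    obtain ⟨H, hH⟩ := ihq
    refine ⟨G.seq H, fun s s' => ?_⟩
    simp only [FlowGraph.reach_seq_iff, hG, hH]
    rfl
  | star p ih =>
    obtain ⟨G, hG⟩ := ih
    refine ⟨G.star, fun s s' => ?_⟩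
    simp only [FlowGraph.reach_star_iff, hG]
    rfl

/-! ### Auxiliary formulas -/

/-- The formula that holds everywhere. -/
def CForm.top : CForm := .not (.and (.atom 0) (.not (.atom 0)))

/-- Finite conjunctions. -/
def CForm.conj : List CForm → CForm
  | [] => .top
  | φ :: l => .and φ (conj l)

/-- Finite disjunctions. -/
def CForm.disj (l : List CForm) : CForm := .not (conj (l.map .not))

/-- No `ψ`-state is reachable by a run whose strict prefix satisfies `e c k`. -/
def CForm.never (e : LinExp) (c : Cmp) (k : ℤ) (ψ : CForm) : CForm := .not (.eu .top e c k ψ)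

/-- No reachable state satisfies `ψ`. -/
def CForm.neverAny (ψ : CForm) : CForm := .never (.term 1 .top) .ge 0 ψ

/-- Some successor satisfies `ψ`. -/
def CForm.next (ψ : CForm) : CForm := .eu .top (.term 1 .top) .eq 1 ψ

section Semantics

variable {Q : Type} {S : Kripke Q} {q : Q}

@[simp] theorem sat_top : sat S .top q ↔ True := by
  simp [CForm.top, sat]

@[simp] theorem sat_conj {l : List CForm} : sat S (.conj l) q ↔ ∀ φ ∈ l, sat S φ q := by
  induction l with
  | nil => simp [CForm.conj]
  | cons φ l ih => simp [CForm.conj, sat, ih]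

@[simp] theorem sat_disj {l : List CForm} : sat S (.disj l) q ↔ ∃ φ ∈ l, sat S φ q := by
  simp [CForm.disj, sat]

theorem sat_never {e : LinExp} {c : Cmp} {k : ℤ} {ψ : CForm} :
    sat S (.never e c k ψ) q ↔ ∀ ρ, S.Run ρ → ρ 0 = q → ∀ i, sat S ψ (ρ i) →
      ¬ c.eval (lval S e (runPrefix ρ i)) k := by
  simp [CForm.never, sat]

theorem runPrefix_succ (ρ : ℕ → Q) (n : ℕ) : runPrefix ρ (n + 1) = runPrefix ρ n ++ [ρ n] := by
  simp [runPrefix, List.range_succ]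

theorem countSat_append_singleton (p : Q → Prop) (l : List Q) (x : Q) :
    countSat p (l ++ [x]) = countSat p l + if p x then 1 else 0 := by
  induction l with
  | nil => simp [countSat]
  | cons y l ih => simp [countSat, ih, add_assoc]

@[simp] theorem lval_term_runPrefix_zero (a : ℤ) (φ : CForm) (ρ : ℕ → Q) :
    lval S (.term a φ) (runPrefix ρ 0) = 0 := by
  simp [lval, runPrefix, countSat]

theorem lval_term_runPrefix_succ (a : ℤ) (φ : CForm) (ρ : ℕ → Q) (n : ℕ) :
    lval S (.term a φ) (runPrefix ρ (n + 1)) =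
      lval S (.term a φ) (runPrefix ρ n) + if sat S φ (ρ n) then a else 0 := by
  simp only [lval, runPrefix_succ, countSat_append_singleton]
  split_ifs <;> push_cast <;> ring

theorem lval_top_runPrefix (ρ : ℕ → Q) (n : ℕ) :
    lval S (.term 1 .top) (runPrefix ρ n) = n := by
  induction n with
  | zero => simp
  | succ n ih => simp [lval_term_runPrefix_succ, ih]

theorem sat_neverAny {ψ : CForm} :
    sat S (.neverAny ψ) q ↔ ∀ ρ, S.Run ρ → ρ 0 = q → ∀ i, ¬ sat S ψ (ρ i) := by
  simp [CForm.neverAny, sat_never, lval_top_runPrefix, Cmp.eval]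

theorem Kripke.exists_run (S : Kripke Q) (q : Q) : ∃ ρ, S.Run ρ ∧ ρ 0 = q := by
  choose next hnext using S.total
  exact ⟨fun n => next^[n] q, fun n => by simpa [iterate_succ_apply'] using hnext _, rfl⟩

theorem sat_next {ψ : CForm} : sat S (.next ψ) q ↔ ∃ q', S.R q q' ∧ sat S ψ q' := by
  simp only [CForm.next, sat, lval_top_runPrefix, Cmp.eval]
  constructor
  · rintro ⟨ρ, hρ, rfl, i, hψ, hi, -⟩
    obtain rfl : i = 1 := by exact_mod_cast hi
    exact ⟨ρ 1, hρ 0, hψ⟩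
  · rintro ⟨q', hR, hψ⟩
    obtain ⟨ρ, hρ, rfl⟩ := S.exists_run q'
    refine ⟨fun n => n.casesOn q ρ, fun n => ?_, rfl, 1, hψ, by simp, fun _ _ => sat_top.2 trivial⟩
    cases n with
    | zero => exact hR
    | succ n => exact hρ n

end Semantics

theorem CForm.PM.top : CForm.top.PM := by simp [CForm.top, CForm.PM]

theorem CForm.PM.conj {l : List CForm} (h : ∀ φ ∈ l, φ.PM) : (CForm.conj l).PM := by
  induction l with
  | nil => exact .top
  | cons φ l ih => exact ⟨h φ (by simp), ih fun ψ hψ => h ψ (by simp [hψ])⟩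

theorem CForm.PM.disj {l : List CForm} (h : ∀ φ ∈ l, φ.PM) : (CForm.disj l).PM :=
  CForm.PM.conj (by simpa [CForm.PM] using h)

theorem CForm.PM.never {e : LinExp} {c : Cmp} {k : ℤ} {ψ : CForm} (he : e.PM) (hψ : ψ.PM) :
    (CForm.never e c k ψ).PM :=
  ⟨.top, he, hψ⟩

theorem CForm.PM.neverAny {ψ : CForm} (hψ : ψ.PM) : (CForm.neverAny ψ).PM :=
  CForm.PM.never ⟨.inl rfl, .top⟩ hψ

theorem CForm.PM.next {ψ : CForm} (hψ : ψ.PM) : (CForm.next ψ).PM :=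
  ⟨.top, ⟨.inl rfl, .top⟩, hψ⟩

/-! ### Instructions and integer-valued registers -/

/-- The condition under which an instruction can be executed. -/
def Act.Guard : Act → (ℕ → ℤ) → Prop
  | .inc _, _ => True
  | .dec i, x => 1 ≤ x i
  | .eq i j, x => x i = x j

/-- The change of register `r` caused by an instruction. -/
def Act.delta (a : Act) (r : ℕ) : ℤ :=
  (if a = .inc r then 1 else 0) + if a = .dec r then -1 else 0

theorem Act.guard_iff {a : Act} {s : ℕ → ℕ} :
    a.Guard (fun r => s r) ↔ ∃ s', a.Step s s' := by
  cases a <;> simp [Act.Guard, Act.Step, Nat.one_le_iff_ne_zero]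

theorem Act.Step.add_delta {a : Act} {s s' : ℕ → ℕ} (h : a.Step s s') (r : ℕ) :
    (s' r : ℤ) = s r + a.delta r := by
  cases a with
  | inc i =>
    obtain rfl := h
    by_cases hr : i = r
    · simp [Act.delta, hr]
    · simp [Act.delta, hr, update_of_ne (Ne.symm hr)]
  | dec i =>
    obtain ⟨h0, rfl⟩ := h
    by_cases hr : i = r
    · subst hr
      simp only [update_self, Act.delta, reduceCtorEq, if_true, if_false]
      omega
    · simp [Act.delta, hr, update_of_ne (Ne.symm hr)]
  | eq i j =>
    obtain ⟨-, rfl⟩ := h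
    simp [Act.delta]

/-! ### The formula describing the runs of a flow graph -/

namespace FlowGraph

variable (G : FlowGraph)

/-- The atomic proposition marking a node. -/
def idx (o : Option G.V) : ℕ := Fintype.equivFin (Option G.V) o

theorem idx_injective : Injective G.idx :=
  Fin.val_injective.comp (Equiv.injective _)

/-- The current node satisfies `P`. -/
def atNode (P : Option G.V → Prop) : CForm :=
  .disj ((Finset.univ.filter P).toList.map fun o => .atom (G.idx o))

/-- Conjunction over all nodes. -/
def all (F : Option G.V → CForm) : CForm := .conj (Finset.univ.toList.map F)

/-- Number of increments of register `r`, with coefficient `a`. -/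
def incs (a : ℤ) (r : ℕ) : LinExp := .term a (G.atNode fun o => ∃ v, o = some v ∧ G.act v = .inc r)

/-- Number of decrements of register `r`, with coefficient `a`. -/
def decs (a : ℤ) (r : ℕ) : LinExp := .term a (G.atNode fun o => ∃ v, o = some v ∧ G.act v = .dec r)

/-- The value of register `r`. -/
def value (r : ℕ) : LinExp := .add (G.incs 1 r) (G.decs (-1) r)

/-- The difference of the values of registers `i` and `j`. -/
def diff (i j : ℕ) : LinExp := .add (G.value i) (.add (G.incs (-1) j) (G.decs 1 j))

/-- The guard of an instruction holds whenever `ψ` does. -/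
def guardForm (ψ : CForm) : Act → CForm
  | .inc _ => .top
  | .dec i => .never (G.value i) .lt 1 ψ
  | .eq i j => .and (.never (G.diff i j) .lt 0 ψ) (.never (G.diff i j) .gt 0 ψ)

/-- All runs follow the flow graph. -/
def spec : CForm := .conj [
  G.atNode (· = some G.init),
  G.all fun o => .neverAny (.and (G.atNode (· = o)) (G.atNode (· ≠ o))),
  G.all fun o => o.elim .top fun v =>
    .neverAny (.and (G.atNode (· = some v)) (.next (.not (G.atNode (G.E v))))),
  G.all fun o => o.elim .top fun v => G.guardForm (G.atNode (· = some v)) (G.act v)]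

/-- The flow graph can exit with value `n` in register `0`. -/
def sentence (n : ℕ) : CForm :=
  .and G.spec (.eu (.not (G.atNode (· = none))) (G.value 0) .eq n (G.atNode (· = none)))

theorem pm_atNode (P : Option G.V → Prop) : (G.atNode P).PM :=
  CForm.PM.disj (by simp [CForm.PM])

theorem pm_value (r : ℕ) : (G.value r).PM :=
  ⟨⟨.inl rfl, G.pm_atNode _⟩, ⟨.inr rfl, G.pm_atNode _⟩⟩

theorem pm_diff (i j : ℕ) : (G.diff i j).PM :=
  ⟨G.pm_value i, ⟨.inr rfl, G.pm_atNode _⟩, ⟨.inl rfl, G.pm_atNode _⟩⟩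

theorem pm_all {F : Option G.V → CForm} (h : ∀ o, (F o).PM) : (G.all F).PM :=
  CForm.PM.conj (by simpa using h)

theorem pm_guardForm {ψ : CForm} (hψ : ψ.PM) (a : Act) : (G.guardForm ψ a).PM := by
  cases a with
  | inc i => exact .top
  | dec i => exact .never (G.pm_value i) hψ
  | eq i j => exact ⟨.never (G.pm_diff i j) hψ, .never (G.pm_diff i j) hψ⟩

theorem pm_spec : G.spec.PM := by
  refine CForm.PM.conj ?_
  simp only [List.forall_mem_cons, List.not_mem_nil, false_implies, implies_true, and_true]
  refine ⟨G.pm_atNode _, G.pm_all fun o => .neverAny ⟨G.pm_atNode _, G.pm_atNode _⟩,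
    G.pm_all fun o => ?_, G.pm_all fun o => ?_⟩
  · cases o with
    | none => exact .top
    | some v => exact .neverAny ⟨G.pm_atNode _, .next (G.pm_atNode _)⟩
  · cases o with
    | none => exact .top
    | some v => exact G.pm_guardForm (G.pm_atNode _) _

theorem pm_sentence (n : ℕ) : (G.sentence n).PM :=
  ⟨G.pm_spec, G.pm_atNode _, G.pm_value 0, G.pm_atNode _⟩

variable {G} {Q : Type} {S : Kripke Q} {q : Q}

@[simp] theorem sat_atNode {P : Option G.V → Prop} :
    sat S (G.atNode P) q ↔ ∃ o, P o ∧ S.label q (G.idx o) := by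
  simp [atNode, sat]

@[simp] theorem sat_all {F : Option G.V → CForm} :
    sat S (G.all F) q ↔ ∀ o, sat S (F o) q := by
  simp [all]

theorem lval_diff (i j : ℕ) (l : List Q) :
    lval S (G.diff i j) l = lval S (G.value i) l - lval S (G.value j) l := by
  simp [diff, value, incs, decs, lval]
  ring

theorem sat_guardForm {ψ : CForm} {a : Act} :
    sat S (G.guardForm ψ a) q ↔ ∀ ρ, S.Run ρ → ρ 0 = q → ∀ i, sat S ψ (ρ i) →
      a.Guard fun r => lval S (G.value r) (runPrefix ρ i) := by
  cases a with
  | inc i => simp [guardForm, Act.Guard]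
  | dec i => simp only [guardForm, sat_never, Cmp.eval, not_lt, Act.Guard]
  | eq i j =>
    simp only [guardForm, sat, sat_never, Cmp.eval, lval_diff, Act.Guard, gt_iff_lt, not_lt,
      sub_nonneg, sub_nonpos]
    constructor
    · rintro ⟨h, h'⟩ ρ hρ h0 i hi
      exact le_antisymm (h' ρ hρ h0 i hi) (h ρ hρ h0 i hi)
    · intro h
      exact ⟨fun ρ hρ h0 i hi => (h ρ hρ h0 i hi).ge, fun ρ hρ h0 i hi => (h ρ hρ h0 i hi).le⟩

theorem sat_spec : sat S G.spec q ↔ S.label q (G.idx (some G.init)) ∧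
    ∀ ρ, S.Run ρ → ρ 0 = q → ∀ i,
      (∀ o o', S.label (ρ i) (G.idx o) → S.label (ρ i) (G.idx o') → o' = o) ∧
      ∀ v, S.label (ρ i) (G.idx (some v)) →
        (∀ q', S.R (ρ i) q' → ∃ o, G.E v o ∧ S.label q' (G.idx o)) ∧
        (G.act v).Guard fun r => lval S (G.value r) (runPrefix ρ i) := by
  simp only [spec, sat_conj, List.forall_mem_cons, List.not_mem_nil, false_implies, implies_true,
    and_true, sat_atNode, exists_eq_left, sat_all]
  refine and_congr_right fun _ => ?_
  constructor
  · rintro ⟨h1, h2, h3⟩ ρ hρ h0 i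
    simp only [sat_neverAny, sat, sat_atNode, exists_eq_left] at h1
    refine ⟨fun o o' ho ho' => ?_, fun v hv => ⟨fun q' hq' => ?_, ?_⟩⟩
    · by_contra h
      exact h1 o ρ hρ h0 i ⟨ho, o', h, ho'⟩
    · have h2 := h2 (some v)
      simp only [Option.elim_some, sat_neverAny, sat, sat_atNode, exists_eq_left, sat_next] at h2
      by_contra h
      exact h2 ρ hρ h0 i ⟨hv, q', hq', h⟩
    · have h3 := h3 (some v)
      simp only [Option.elim_some, sat_guardForm, sat_atNode, exists_eq_left] at h3
      exact h3 ρ hρ h0 i hv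
  · intro h
    refine ⟨fun o => ?_, fun o => ?_, fun o => ?_⟩
    · simp only [sat_neverAny, sat, sat_atNode, exists_eq_left]
      rintro ρ hρ h0 i ⟨ho, o', hne, ho'⟩
      exact hne ((h ρ hρ h0 i).1 o o' ho ho')
    · cases o with
      | none => exact sat_top.2 trivial
      | some v =>
        simp only [Option.elim_some, sat_neverAny, sat, sat_atNode, exists_eq_left, sat_next]
        rintro ρ hρ h0 i ⟨hv, q', hq', hn⟩
        exact hn (((h ρ hρ h0 i).2 v hv).1 q' hq')
    · cases o with
      | none => exact sat_top.2 trivial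
      | some v =>
        simp only [Option.elim_some, sat_guardForm, sat_atNode, exists_eq_left]
        exact fun ρ hρ h0 i hv => ((h ρ hρ h0 i).2 v hv).2

@[simp] theorem lval_value_runPrefix_zero (r : ℕ) (ρ : ℕ → Q) :
    lval S (G.value r) (runPrefix ρ 0) = 0 := by
  simp [value, incs, decs, lval.eq_2]

theorem lval_value_runPrefix_succ {ρ : ℕ → Q} {i : ℕ} {v : G.V}
    (hu : ∀ o o', S.label (ρ i) (G.idx o) → S.label (ρ i) (G.idx o') → o' = o)
    (hv : S.label (ρ i) (G.idx (some v))) (r : ℕ) :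
    lval S (G.value r) (runPrefix ρ (i + 1)) =
      lval S (G.value r) (runPrefix ρ i) + (G.act v).delta r := by
  have key (a : Act) : (sat S (G.atNode fun o => ∃ v, o = some v ∧ G.act v = a) (ρ i)) ↔
      G.act v = a := by
    rw [sat_atNode]
    constructor
    · rintro ⟨_, ⟨w, rfl, hw⟩, hl⟩
      obtain rfl := Option.some_injective _ (hu _ _ hv hl)
      exact hw
    · exact fun h => ⟨some v, ⟨v, rfl, h⟩, hv⟩
  simp only [value, incs, decs, lval.eq_2, lval_term_runPrefix_succ, key, Act.delta]
  ring

/-- A model of the formula yields a terminating execution. -/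
theorem exists_reach_of_sat {n : ℕ} (h : sat S (G.sentence n) q) :
    ∃ s, G.Reach (some G.init, 0) (none, s) ∧ s 0 = n := by
  simp only [sentence, sat, sat_spec, sat_atNode, exists_eq_left, Cmp.eval] at h
  obtain ⟨⟨hinit, h⟩, ρ, hρ, h0, i, hi, hn, hlt⟩ := h
  replace h := h ρ hρ h0
  have key : ∀ j ≤ i, ∃ o s, S.label (ρ j) (G.idx o) ∧ G.Reach (some G.init, 0) (o, s) ∧
      ∀ r, lval S (G.value r) (runPrefix ρ j) = s r := by
    intro j
    induction j with
    | zero => exact fun _ => ⟨some G.init, 0, h0 ▸ hinit, .refl, by simp⟩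
    | succ j ih =>
      intro hj
      obtain ⟨o, s, ho, hr, hs⟩ := ih (by omega)
      cases o with
      | none => exact absurd ho (hlt j hj)
      | some v =>
        obtain ⟨hu, hv⟩ := h j
        obtain ⟨hE, hg⟩ := hv v ho
        simp only [hs] at hg
        obtain ⟨s', hs'⟩ := Act.guard_iff.1 hg
        obtain ⟨o', ho', hl⟩ := hE _ (hρ j)
        refine ⟨o', s', hl, hr.tail ⟨v, rfl, ho', hs'⟩, fun r => ?_⟩
        rw [lval_value_runPrefix_succ hu ho, hs, hs'.add_delta]
  obtain ⟨o, s, ho, hr, hs⟩ := key i le_rfl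
  obtain rfl : o = none := (h i).1 _ _ hi ho
  exact ⟨s, hr, by exact_mod_cast (hs 0).symm.trans hn⟩

end FlowGraph

theorem exists_path_of_reflTransGen {α : Type*} {r : α → α → Prop} {a b : α}
    (h : ReflTransGen r a b) :
    ∃ (c : ℕ → α) (k : ℕ), c 0 = a ∧ c k = b ∧ ∀ i < k, r (c i) (c (i + 1)) := by
  induction h using ReflTransGen.head_induction_on with
  | refl => exact ⟨fun _ => b, 0, rfl, rfl, by simp⟩
  | @head a a' h _ ih =>
    obtain ⟨c, k, h0, hk, hc⟩ := ih
    refine ⟨fun n => n.casesOn a c, k + 1, rfl, hk, fun i hi => ?_⟩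
    cases i with
    | zero =>
      rw [← h0] at h
      exact h
    | succ i => exact hc i (by omega)

/-- The finite presentation of a path of length `k` ending in a loop, with one label per state. -/
def FinKS.lasso (k : ℕ) (l : ℕ → ℕ) : FinKS where
  n := k + 1
  edges := (List.range (k + 1)).map fun i => (i, min (i + 1) k)
  labels := (List.range (k + 1)).map fun i => (i, l i)

theorem FinKS.total_lasso (k : ℕ) (l : ℕ → ℕ) : (lasso k l).Total := fun q =>
  ⟨⟨min (q + 1) k, Nat.lt_succ_of_le (min_le_right _ _)⟩,
    List.mem_map.2 ⟨q, List.mem_range.2 q.isLt, rfl⟩⟩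

section Lasso

variable {k : ℕ} {l : ℕ → ℕ} {a b : Fin (FinKS.lasso k l).n}

theorem FinKS.lasso_R :
    ((lasso k l).toKripke (total_lasso k l)).R a b ↔ (b : ℕ) = min ((a : ℕ) + 1) k := by
  have := a.isLt
  simp only [lasso] at this
  simp only [toKripke, lasso, List.mem_map, List.mem_range, Prod.mk.injEq]
  constructor
  · rintro ⟨i, -, hi, hb⟩
    rw [← hb, hi]
  · exact fun h => ⟨a, this, rfl, h.symm⟩

theorem FinKS.lasso_label {p : ℕ} :
    ((lasso k l).toKripke (total_lasso k l)).label a p ↔ p = l a := by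
  have := a.isLt
  simp only [lasso] at this
  simp only [toKripke, lasso, List.mem_map, List.mem_range, Prod.mk.injEq]
  constructor
  · rintro ⟨i, -, hi, hp⟩
    rw [← hp, hi]
  · exact fun h => ⟨a, this, rfl, h.symm⟩

theorem FinKS.lasso_run {ρ : ℕ → Fin (lasso k l).n}
    (hρ : ((lasso k l).toKripke (total_lasso k l)).Run ρ) (h0 : (ρ 0 : ℕ) = 0) (i : ℕ) :
    (ρ i : ℕ) = min i k := by
  induction i with
  | zero => simpa using h0
  | succ i ih =>
    rw [lasso_R.1 (hρ i), ih]
    omega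

end Lasso

/-- A terminating execution yields a finite model of the formula. -/
theorem FlowGraph.exists_sat_of_reach {G : FlowGraph} {n : ℕ} {s : ℕ → ℕ}
    (h : G.Reach (some G.init, 0) (none, s)) (hs : s 0 = n) :
    ∃ (M : FinKS) (hM : M.Total) (q : Fin M.n), sat (M.toKripke hM) (G.sentence n) q := by
  obtain ⟨c, k, h0, hk, hc⟩ := exists_path_of_reflTransGen h
  let l : ℕ → ℕ := fun i => G.idx (c i).1
  let S := (FinKS.lasso k l).toKripke (FinKS.total_lasso k l)
  let q : Fin (FinKS.lasso k l).n := ⟨0, k.succ_pos⟩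
  refine ⟨FinKS.lasso k l, FinKS.total_lasso k l, q, ?_⟩
  change sat S _ q
  have label {a : Fin (FinKS.lasso k l).n} {o : Option G.V} :
      S.label a (G.idx o) ↔ o = (c a).1 :=
    FinKS.lasso_label.trans G.idx_injective.eq_iff
  have run {ρ : ℕ → Fin (FinKS.lasso k l).n} (hρ : S.Run ρ) (hq : ρ 0 = q) (i : ℕ) :
      (ρ i : ℕ) = min i k :=
    FinKS.lasso_run hρ (by rw [hq]) i
  have uniq (a : Fin (FinKS.lasso k l).n) (o o' : Option G.V) (ho : S.label a (G.idx o))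
      (ho' : S.label a (G.idx o')) : o' = o :=
    (label.1 ho').trans (label.1 ho).symm
  have value {ρ : ℕ → Fin (FinKS.lasso k l).n} (hρ : S.Run ρ) (hq : ρ 0 = q) :
      ∀ i ≤ k, ∀ r, lval S (G.value r) (runPrefix ρ i) = (c i).2 r := by
    intro i
    induction i with
    | zero => simp [h0]
    | succ i ih =>
      intro hi r
      obtain ⟨v, hv, -, hstep⟩ := hc i hi
      have hl : S.label (ρ i) (G.idx (some v)) := by
        rw [label, run hρ hq, min_eq_left (by omega), hv]
      rw [lval_value_runPrefix_succ (uniq _) hl, ih (by omega), hstep.add_delta]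
  simp only [sentence, sat, sat_spec, sat_atNode, exists_eq_left, Cmp.eval]
  refine ⟨⟨label.2 (by simp [q, h0]), fun ρ hρ hq i => ⟨uniq _, fun v hv => ?_⟩⟩, ?_⟩
  · rw [label, run hρ hq] at hv
    have hi : i < k := by
      by_contra hi
      rw [min_eq_right (by omega), hk] at hv
      cases hv
    rw [min_eq_left hi.le] at hv
    obtain ⟨w, hw, hE, hstep⟩ := hc i hi
    obtain rfl : v = w := Option.some_injective _ (hv.trans hw)
    refine ⟨fun q' hq' => ⟨_, hE, label.2 ?_⟩, ?_⟩
    · rw [FinKS.lasso_R.1 hq', run hρ hq, min_eq_left hi.le, min_eq_left hi]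
    · simp only [value hρ hq i hi.le]
      exact Act.guard_iff.2 ⟨_, hstep⟩
  · obtain ⟨ρ, hρ, hq⟩ := S.exists_run q
    refine ⟨ρ, hρ, hq, k, label.2 ?_, ?_, fun j hj hn => ?_⟩
    · rw [run hρ hq, min_self, hk]
    · rw [value hρ hq k le_rfl, hk, ← hs]
    · obtain ⟨v, hv, -⟩ := hc j hj
      rw [label, run hρ hq, min_eq_left hj.le, hv] at hn
      cases hn

theorem primrec_encode_natCast : Primrec fun n : ℕ => Encodable.encode (n : ℤ) := by
  have h (n : ℕ) : Encodable.encode (n : ℤ) = 2 * n := by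
    rfl
  simp only [h]
  exact Primrec.nat_mul.comp (.const 2) .id

theorem FlowGraph.primrec_encForm_sentence (G : FlowGraph) :
    Primrec fun n => encForm (G.sentence n) := by
  have pair {f g : ℕ → ℕ} (hf : Primrec f) (hg : Primrec g) :
      Primrec fun n => Nat.pair (f n) (g n) :=
    Primrec₂.natPair.comp hf hg
  simp only [sentence, encForm]
  exact pair (.const _) (pair (.const _) (pair (.const _) (pair (.const _) (pair (.const _)
    (pair (.const _) (pair primrec_encode_natCast (.const _)))))))

/-- satisfiability of CCTL±1 is undecidable: no computable
function decides, with respect to the natural encoding of formulas,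
whether a CCTL±1 formula is satisfied at some state of some finite Kripke
structure. -/
theorem cctl_pm_sat_undecidable :
    ¬ ∃ f : ℕ → Bool, Computable f ∧
      ∀ Φ : CForm, Φ.PM →
        (f (encForm Φ) = true ↔
          ∃ (M : FinKS) (hM : M.Total) (q : Fin M.n),
            sat (M.toKripke hM) Φ q) := by
  rintro ⟨f, hf, h⟩
  obtain ⟨p, hp⟩ := exists_prog_not_computable
  obtain ⟨G, hG⟩ := p.exists_flowGraph
  refine hp (ComputablePred.computable_iff.2
    ⟨_, hf.comp G.primrec_encForm_sentence.to_comp, funext fun n => propext ?_⟩)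
  rw [h _ (G.pm_sentence n)]
  simp only [← hG]
  constructor
  · rintro ⟨s, hs, hn⟩
    exact G.exists_sat_of_reach hs hn
  · rintro ⟨M, hM, q, hq⟩
    exact G.exists_reach_of_sat hq
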